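/- Let P be a bounded full-dimensional convex polytope in ℝ^d with no supporting hyperplane parallel to {x_d = 0}, and let τ_0 < τ_1 < … < τ_m be the distinct last coordinates of the vertices of P. Then the function φ(t) = Vol_{d-1}(P ∩ {x_d = t}) is continuous on ℝ and agrees with a polynomial of degree ≤ d-1 on each interval (τ_i, τ_{i+1}). -/

import Mathlib

open MeasureTheory Set

/-- The open simplicial cone of all strictly positive combinations of the vectors `w`. -/
def openCone {F κ : Type*} [AddCommGroup F] [Module ℝ F] [Fintype κ] (w : κ → F) : Set F :=
  {v | ∃ c : κ → ℝ, (∀ j, 0 < c j) ∧ ∑ j, c j • w j = v}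

/-- A lexicographic sign: a notion of negativity on `ι → ℝ` for which every nonzero vector or its
opposite is negative, and every nonempty compact set has a minimal element. -/
theorem exists_lex_sign (ι : Type*) [Finite ι] : ∃ Neg : (ι → ℝ) → Prop,
    (∀ c, c ≠ 0 → Neg c ∨ Neg (-c)) ∧ (∀ c (ε : ℝ), 0 < ε → Neg c → Neg (ε • c)) ∧
    ∀ K : Set (ι → ℝ), IsCompact K → K.Nonempty → ∃ x ∈ K, ∀ y ∈ K, ¬ Neg (y - x) := by
  induction ι using Finite.induction_empty_option with
  | of_equiv e ih =>
    obtain ⟨Neg, h1, h2, h3⟩ := ih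
    refine ⟨fun c => Neg (c ∘ e), fun c hc => h1 _ fun h => hc ?_, fun c ε hε hc => h2 _ ε hε hc,
      fun K hK hne => ?_⟩
    · funext i
      simpa using congrFun h (e.symm i)
    · obtain ⟨_, ⟨x, hx, rfl⟩, hmin⟩ := h3 ((fun c => c ∘ e) '' K)
        (hK.image (by fun_prop)) (hne.image _)
      exact ⟨x, hx, fun y hy => hmin _ ⟨y, hy, rfl⟩⟩
  | h_empty =>
    exact ⟨fun _ => False, fun c hc => (hc (Subsingleton.elim _ _)).elim, by simp,
      fun K _ hne => hne.imp fun x hx => ⟨hx, by simp⟩⟩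
  | h_option ih =>
    obtain ⟨Neg, h1, h2, h3⟩ := ih
    refine ⟨fun c => c none < 0 ∨ c none = 0 ∧ Neg (c ∘ some), fun c hc => ?_, ?_,
      fun K hK hne => ?_⟩
    · rcases lt_trichotomy (c none) 0 with h | h | h
      · exact .inl (.inl h)
      · have hs : c ∘ some ≠ 0 := fun h' => hc <| by
          funext i
          cases i with
          | none => exact h
          | some i => exact congrFun h' i
        rcases h1 _ hs with h' | h'
        · exact .inl (.inr ⟨h, h'⟩)
        · exact .inr (.inr ⟨by simp [h], h'⟩)
      · exact .inr (.inl (by simpa using h))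
    · rintro c ε hε (h | ⟨h, h'⟩)
      · exact .inl (by simpa using mul_neg_of_pos_of_neg hε h)
      · exact .inr ⟨by simp [h], h2 _ ε hε h'⟩
    · obtain ⟨x₀, hx₀, hm⟩ := hK.exists_isMinOn hne
        (f := fun c : _ → ℝ => c none) (by fun_prop)
      obtain ⟨_, ⟨x, ⟨hx, hxn⟩, rfl⟩, hmin⟩ := h3
        ((fun c => c ∘ some) '' (K ∩ {c | c none = x₀ none}))
        ((hK.inter_right (isClosed_eq (by fun_prop) (by fun_prop))).image (by fun_prop))
        ⟨_, x₀, ⟨hx₀, rfl⟩, rfl⟩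
      refine ⟨x, hx, fun y hy => ?_⟩
      have hle : x₀ none ≤ y none := hm hy
      simp only [mem_ofPred_eq] at hxn
      rintro (h | ⟨h, h'⟩) <;> simp only [Pi.sub_apply] at h
      · linarith
      · exact hmin _ ⟨y, ⟨hy, by simp only [mem_ofPred_eq]; linarith⟩, rfl⟩ h'

/-- A finitely generated pointed cone is a disjoint union of open simplicial cones spanned by
linearly independent subfamilies of the generators. -/
theorem exists_simplicial_cells {F ι : Type*} [AddCommGroup F] [Module ℝ F] [TopologicalSpace F]
    [ContinuousAdd F] [ContinuousSMul ℝ F] [T2Space F] [Fintype ι] (w : ι → F)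
    (l : F →ₗ[ℝ] ℝ) (hl : ∀ j, l (w j) = 1) :
    ∃ T : Set (Finset ι), (∀ σ ∈ T, LinearIndependent ℝ fun j : σ => w j) ∧
      (T.PairwiseDisjoint fun σ => openCone fun j : σ => w j) ∧
      ∀ c : ι → ℝ, (∀ j, 0 ≤ c j) → ∃ σ ∈ T, ∑ j, c j • w j ∈ openCone fun j : σ => w j := by
  classical
  obtain ⟨Neg, h1, h2, h3⟩ := exists_lex_sign ι
  have ext_zero : ∀ (σ : Finset ι) (g : σ → ℝ), ∃ c : ι → ℝ, (∀ j : σ, c j = g j) ∧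
      (∀ j ∉ σ, c j = 0) ∧ ∑ j, c j • w j = ∑ j : σ, g j • w j := by
    intro σ g
    refine ⟨fun j => if h : j ∈ σ then g ⟨j, h⟩ else 0, by simp, fun j hj => by simp [hj], ?_⟩
    rw [← Finset.sum_subset (Finset.subset_univ σ) (by intro j _ hj; simp [hj]),
      ← Finset.sum_coe_sort]
    simp
  refine ⟨{σ | ∀ c : ι → ℝ, ∑ j, c j • w j = 0 → (∀ j ∉ σ, 0 ≤ c j) → ¬ Neg c}, ?_, ?_, ?_⟩
  · intro σ hσ
    rw [Fintype.linearIndependent_iff]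
    intro g hg
    obtain ⟨c, hc, hc0, hsum⟩ := ext_zero σ g
    rw [hg] at hsum
    have : c = 0 := by
      by_contra hne
      rcases h1 c hne with h | h
      · exact hσ c hsum (fun j hj => (hc0 j hj).ge) h
      · exact hσ (-c) (by simp [hsum]) (fun j hj => by simp [hc0 j hj]) h
    intro j
    rw [← hc, this, Pi.zero_apply]
  · intro σ hσ τ hτ hne
    refine Set.disjoint_left.2 ?_
    rintro _ ⟨f, hf, rfl⟩ ⟨g, hg, hfg⟩
    obtain ⟨c, hc, hc0, hcs⟩ := ext_zero σ f
    obtain ⟨d, hd, hd0, hds⟩ := ext_zero τ g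
    have hcpos : ∀ j, j ∈ σ ↔ 0 < c j := fun j =>
      ⟨fun h => (hf ⟨j, h⟩).trans_eq (hc ⟨j, h⟩).symm, fun h => by
        by_contra h'; exact h.ne' (hc0 j h')⟩
    have hdpos : ∀ j, j ∈ τ ↔ 0 < d j := fun j =>
      ⟨fun h => (hg ⟨j, h⟩).trans_eq (hd ⟨j, h⟩).symm, fun h => by
        by_contra h'; exact h.ne' (hd0 j h')⟩
    have hcn : ∀ j, 0 ≤ c j := fun j => by
      by_cases h : j ∈ σ
      · exact ((hcpos j).1 h).le
      · exact (hc0 j h).ge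
    have hdn : ∀ j, 0 ≤ d j := fun j => by
      by_cases h : j ∈ τ
      · exact ((hdpos j).1 h).le
      · exact (hd0 j h).ge
    have hs : ∑ j, (d - c) j • w j = 0 := by
      simp only [Pi.sub_apply, sub_smul, Finset.sum_sub_distrib, hcs, hds, hfg, sub_self]
    have : d - c = 0 := by
      by_contra hne'
      rcases h1 _ hne' with h | h
      · exact hσ _ hs (fun j hj => by simp [hc0 j hj, hdn j]) h
      · refine hτ (-(d - c)) ?_ (fun j hj => by simp [hd0 j hj, hcn j]) h
        simp only [Pi.neg_apply, neg_smul, Finset.sum_neg_distrib, hs, neg_zero]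
    refine hne (Finset.ext fun j => ?_)
    rw [hcpos, hdpos, sub_eq_zero.1 this]
  · intro c₀ hc₀
    set K : Set (ι → ℝ) := {c | (∀ j, 0 ≤ c j) ∧ ∑ j, c j • w j = ∑ j, c₀ j • w j} with hK
    have hclosed : IsClosed K := by
      simp only [hK, ofPred_and, ofPred_forall]
      refine (isClosed_iInter fun j => isClosed_le (by fun_prop) (by fun_prop)).inter
        (isClosed_eq (by fun_prop) (by fun_prop))
    have hKc : IsCompact K := by
      refine (isCompact_Icc (a := (0 : ι → ℝ)) (b := fun _ => ∑ j, c₀ j)).of_isClosed_subset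
        hclosed fun c hc => ⟨hc.1, fun j => ?_⟩
      have : ∑ j, c j = ∑ j, c₀ j := by simpa [hl] using congrArg l hc.2
      rw [← this]
      exact Finset.single_le_sum (fun i _ => hc.1 i) (Finset.mem_univ j)
    obtain ⟨c, ⟨hc, hcs⟩, hmin⟩ := h3 K hKc ⟨c₀, hc₀, rfl⟩
    refine ⟨Finset.univ.filter fun j => 0 < c j, fun d hd hd0 hneg => ?_,
      fun j => c j, fun j => (Finset.mem_filter.1 j.2).2, ?_⟩
    · have hev : ∀ᶠ ε in nhdsWithin (0 : ℝ) (Ioi 0), ∀ j, 0 ≤ c j + ε * d j := by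
        rw [Filter.eventually_all]
        intro j
        rcases (hc j).eq_or_lt with h | h
        · filter_upwards [self_mem_nhdsWithin] with ε hε
          have := hd0 j (by simp [← h])
          rw [← h, zero_add]
          exact mul_nonneg (le_of_lt hε) this
        · have : Filter.Tendsto (fun ε : ℝ => c j + ε * d j) (nhds 0) (nhds (c j + 0 * d j)) :=
            (Continuous.tendsto (by fun_prop) 0)
          rw [zero_mul, add_zero] at this
          exact ((this.eventually (lt_mem_nhds h)).mono fun _ => le_of_lt).filter_mono
            nhdsWithin_le_nhds
      obtain ⟨ε, hε, hpos⟩ := (hev.and self_mem_nhdsWithin).exists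
      refine hmin (c + ε • d) ⟨hε, ?_⟩ (by simpa using h2 d ε hpos hneg)
      simp only [Pi.add_apply, Pi.smul_apply, add_smul, Finset.sum_add_distrib, hcs, smul_assoc,
        ← Finset.smul_sum, hd, smul_zero, add_zero]
    · rw [← hcs, Finset.sum_coe_sort (Finset.univ.filter fun j => 0 < c j) fun j => c j • w j]
      refine Finset.sum_subset (Finset.subset_univ _) fun j _ hj => ?_
      have : c j = 0 := le_antisymm (by simpa using hj) (hc j)
      simp [this]

section Cells

variable {E : Type*} [NormedAddCommGroup E] [NormedSpace ℝ E] [FiniteDimensional ℝ E]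

theorem exists_polynomial_abs_det (X Y : E →ₗ[ℝ] E)
    (h : ∀ s ∈ Ioo (0 : ℝ) 1, LinearMap.det ((1 - s) • X + s • Y) ≠ 0) :
    ∃ q : Polynomial ℝ, q.natDegree ≤ Module.finrank ℝ E ∧
      ∀ s ∈ Ioo (0 : ℝ) 1, |LinearMap.det ((1 - s) • X + s • Y)| = q.eval s := by
  let b := Module.finBasis ℝ E
  let A := LinearMap.toMatrix b b X
  let B := LinearMap.toMatrix b b Y
  let q : Polynomial ℝ :=
    (Polynomial.X (R := ℝ) • (B - A).map Polynomial.C + A.map Polynomial.C).det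
  have hdeg : q.natDegree ≤ Module.finrank ℝ E := by
    simpa using Polynomial.natDegree_det_X_add_C_le (B - A) A
  have heval : ∀ s, LinearMap.det ((1 - s) • X + s • Y) = q.eval s := by
    intro s
    rw [← LinearMap.det_toMatrix b, ← Polynomial.coe_evalRingHom, RingHom.map_det]
    congr 1
    ext i j
    simp [A, B]
    ring
  simp only [heval] at h ⊢
  by_cases hpos : ∃ s ∈ Ioo (0 : ℝ) 1, 0 < q.eval s
  · obtain ⟨s₀, hs₀, h₀⟩ := hpos
    refine ⟨q, hdeg, fun s hs => abs_of_nonneg ?_⟩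
    by_contra! hneg
    obtain ⟨r, hr, hr0⟩ := isPreconnected_Ioo.intermediate_value hs hs₀
      q.continuous.continuousOn ⟨hneg.le, h₀.le⟩
    exact h r hr hr0
  · push Not at hpos
    exact ⟨-q, by simpa using hdeg, fun s hs => by
      rw [Polynomial.eval_neg]; exact abs_of_nonpos (hpos s hs)⟩

variable [MeasurableSpace E] [BorelSpace E] (μ : Measure E) [μ.IsAddHaarMeasure]

theorem measure_openCone_slice_of_basis {κ : Type*} [Fintype κ] (b : Module.Basis κ ℝ (E × ℝ × ℝ))
    (hb : ∀ j, (b j).2 = (1, 0) ∨ (b j).2 = (0, 1)) :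
    ∃ q : Polynomial ℝ, q.natDegree ≤ Module.finrank ℝ E ∧ ∀ s ∈ Ioo (0 : ℝ) 1,
      (μ {x | (x, 1 - s, s) ∈ openCone b}).toReal = q.eval s := by
  have mem_iff : ∀ v, v ∈ openCone b ↔ ∀ j, 0 < b.repr v j := by
    intro v
    refine ⟨?_, fun h => ⟨b.repr v, h, b.sum_repr v⟩⟩
    rintro ⟨c, hc, rfl⟩ j
    rw [b.repr_sum_self]
    exact hc j
  let X : (E × ℝ × ℝ) →ₗ[ℝ] (E × ℝ × ℝ) := b.constr ℝ fun j => (b j).2.1 • b j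
  let Y : (E × ℝ × ℝ) →ₗ[ℝ] (E × ℝ × ℝ) := b.constr ℝ fun j => (b j).2.2 • b j
  have hXb : ∀ j, X (b j) = (b j).2.1 • b j := b.constr_basis ℝ _
  have hYb : ∀ j, Y (b j) = (b j).2.2 • b j := b.constr_basis ℝ _
  have hX : ∀ v, (X v).2 = (v.2.1, 0) := by
    have : (LinearMap.snd ℝ E (ℝ × ℝ)) ∘ₗ X =
        LinearMap.inl ℝ ℝ ℝ ∘ₗ LinearMap.fst ℝ ℝ ℝ ∘ₗ LinearMap.snd ℝ E (ℝ × ℝ) := by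
      refine b.ext fun j => ?_
      rcases hb j with h | h <;> simp [hXb, h, Prod.zero_eq_mk]
    exact fun v => LinearMap.congr_fun this v
  have hY : ∀ v, (Y v).2 = (0, v.2.2) := by
    have : (LinearMap.snd ℝ E (ℝ × ℝ)) ∘ₗ Y =
        LinearMap.inr ℝ ℝ ℝ ∘ₗ LinearMap.snd ℝ ℝ ℝ ∘ₗ LinearMap.snd ℝ E (ℝ × ℝ) := by
      refine b.ext fun j => ?_
      rcases hb j with h | h <;> simp [hYb, h, Prod.zero_eq_mk]
    exact fun v => LinearMap.congr_fun this v
  let M : ℝ → (E × ℝ × ℝ) →ₗ[ℝ] (E × ℝ × ℝ) := fun s => (1 - s) • X + s • Y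
  have hM2 : ∀ s v, (M s v).2 = ((1 - s) * v.2.1, s * v.2.2) := by
    intro s v
    simp [M, hX, hY]
  have hM : ∀ s ∈ Ioo (0 : ℝ) 1, ∀ j, ∃ r > 0, ∀ v, b.repr (M s v) j = r * b.repr v j := by
    intro s hs j
    have hXr : ∀ v, b.repr (X v) j = (b j).2.1 * b.repr v j := by
      have : b.coord j ∘ₗ X = (b j).2.1 • b.coord j := by
        refine b.ext fun k => ?_
        rcases eq_or_ne k j with rfl | h
        · simp [hXb]
        · simp [hXb, h.symm]
      exact fun v => LinearMap.congr_fun this v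
    have hYr : ∀ v, b.repr (Y v) j = (b j).2.2 * b.repr v j := by
      have : b.coord j ∘ₗ Y = (b j).2.2 • b.coord j := by
        refine b.ext fun k => ?_
        rcases eq_or_ne k j with rfl | h
        · simp [hYb]
        · simp [hYb, h.symm]
      exact fun v => LinearMap.congr_fun this v
    rcases hb j with h | h
    · exact ⟨1 - s, sub_pos.2 hs.2, fun v => by simp [M, hXr, hYr, h]⟩
    · exact ⟨s, hs.1, fun v => by simp [M, hXr, hYr, h]⟩
  let pr : ((E × ℝ × ℝ) →ₗ[ℝ] (E × ℝ × ℝ)) → (E →ₗ[ℝ] E) := fun Z =>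
    LinearMap.fst ℝ E (ℝ × ℝ) ∘ₗ Z ∘ₗ LinearMap.inl ℝ E (ℝ × ℝ)
  have hN : ∀ s x, ((1 - s) • pr X + s • pr Y) x = (M s (x, 0)).1 := fun s x => by
    simp [M, pr]
  have hdet : ∀ s ∈ Ioo (0 : ℝ) 1, LinearMap.det ((1 - s) • pr X + s • pr Y) ≠ 0 := by
    intro s hs h0
    refine (LinearMap.bot_lt_ker_of_det_eq_zero h0).ne' ((LinearMap.ker_eq_bot').2 fun x hx => ?_)
    have hz : M s (x, 0) = 0 := by
      refine Prod.ext ?_ ?_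
      · rw [← hN, hx]; rfl
      · rw [hM2]; simp
    have : b.repr (x, 0) = 0 := by
      ext j
      obtain ⟨r, hr, hrj⟩ := hM s hs j
      have := hrj (x, 0)
      rw [hz, map_zero] at this
      simpa [hr.ne'] using this.symm
    simpa using this
  obtain ⟨q, hq, hqe⟩ := exists_polynomial_abs_det (pr X) (pr Y) hdet
  refine ⟨Polynomial.C (μ {x | (x, 1, 1) ∈ openCone b}).toReal * q,
    (Polynomial.natDegree_C_mul_le _ _).trans hq, fun s hs => ?_⟩
  have hset : {x | (x, (1 : ℝ), (1 : ℝ)) ∈ openCone b} = ((1 - s) • pr X + s • pr Y) ⁻¹'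
      ((fun x => x + (M s (0, 1, 1)).1) ⁻¹' {x | (x, 1 - s, s) ∈ openCone b}) := by
    ext x
    have : (((1 - s) • pr X + s • pr Y) x + (M s (0, 1, 1)).1, 1 - s, s) = M s (x, 1, 1) := by
      have hx : ((x, 1, 1) : E × ℝ × ℝ) = (x, 0) + (0, 1, 1) := by ext <;> simp
      refine Prod.ext ?_ ?_
      · rw [hN, hx, map_add]; rfl
      · rw [hM2]; simp
    simp only [mem_preimage, mem_ofPred_eq, this, mem_iff]
    refine forall_congr' fun j => ?_
    obtain ⟨r, hr, hrj⟩ := hM s hs j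
    rw [hrj, mul_pos_iff_of_pos_left hr]
  rw [hset, Measure.addHaar_preimage_linearMap μ (hdet s hs), measure_preimage_add_right,
    Polynomial.eval_mul, Polynomial.eval_C, ← hqe s hs, ENNReal.toReal_mul,
    ENNReal.toReal_ofReal (abs_nonneg _), abs_inv]
  have := abs_pos.2 (hdet s hs)
  field_simp

/-- The slices of an open simplicial cone have polynomial volume. -/
theorem measure_openCone_slice {κ : Type*} [Fintype κ] (w : κ → E × ℝ × ℝ)
    (hw : ∀ j, (w j).2 = (1, 0) ∨ (w j).2 = (0, 1)) (hli : LinearIndependent ℝ w) :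
    ∃ q : Polynomial ℝ, q.natDegree ≤ Module.finrank ℝ E ∧ ∀ s ∈ Ioo (0 : ℝ) 1,
      (μ {x | (x, 1 - s, s) ∈ openCone w}).toReal = q.eval s := by
  by_cases htop : ⊤ ≤ Submodule.span ℝ (range w)
  · have := measure_openCone_slice_of_basis μ (Module.Basis.mk hli htop) (by simpa using hw)
    simpa using this
  refine ⟨0, by simp, fun s hs => ?_⟩
  suffices μ {x | (x, 1 - s, s) ∈ openCone w} = 0 by simp [this]
  rcases eq_empty_or_nonempty {x | (x, 1 - s, s) ∈ openCone w} with h | ⟨x₀, c, hc, hsum⟩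
  · simp [h]
  set S := Submodule.span ℝ (range w)
  have hmem : ∀ j, w j ∈ S := fun j => Submodule.subset_span ⟨j, rfl⟩
  have hsum2 : ∑ j, c j • (w j).2 = (1 - s, s) := by
    simpa [Prod.snd_sum] using congrArg Prod.snd hsum
  obtain ⟨i, hi⟩ : ∃ i, (w i).2 = (1, 0) := by
    by_contra! h
    have h' : ∀ j, (w j).2.1 = 0 := fun j => by rw [(hw j).resolve_left (h j)]
    have := congrArg Prod.fst hsum2
    simp [Prod.fst_sum, h'] at this
    linarith [hs.2]
  obtain ⟨k, hk⟩ : ∃ k, (w k).2 = (0, 1) := by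
    by_contra! h
    have h' : ∀ j, (w j).2.2 = 0 := fun j => by rw [(hw j).resolve_right (h j)]
    have := congrArg Prod.snd hsum2
    simp [Prod.snd_sum, h'] at this
    linarith [hs.1]
  set A : AffineSubspace ℝ E := AffineSubspace.mk' x₀ (S.comap (LinearMap.inl ℝ E (ℝ × ℝ)))
  refine measure_mono_null (t := A) ?_ (Measure.addHaar_affineSubspace μ A fun hA => htop ?_)
  · rintro x ⟨d, hd, hdsum⟩
    rw [SetLike.mem_coe, AffineSubspace.mem_mk', Submodule.mem_comap]
    have : LinearMap.inl ℝ E (ℝ × ℝ) (x -ᵥ x₀) = ∑ j, d j • w j - ∑ j, c j • w j := by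
      rw [hsum, hdsum]; ext <;> simp
    rw [this]
    exact S.sub_mem (S.sum_mem fun j _ => S.smul_mem _ (hmem j))
      (S.sum_mem fun j _ => S.smul_mem _ (hmem j))
  · have hE : ∀ x : E, ((x, 0) : E × ℝ × ℝ) ∈ S := fun x => by
      have : A.direction = ⊤ := by rw [hA, AffineSubspace.direction_top]
      rw [AffineSubspace.direction_mk'] at this
      have hx : x ∈ S.comap (LinearMap.inl ℝ E (ℝ × ℝ)) := this ▸ Submodule.mem_top
      exact hx
    rintro ⟨x, r, t⟩ -
    have : ((x, r, t) : E × ℝ × ℝ) =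
        (x - r • (w i).1 - t • (w k).1, 0) + r • w i + t • w k := by
      ext
      · simp only [Prod.fst_add, Prod.smul_fst]; abel
      all_goals simp [hi, hk]
    rw [this]
    exact S.add_mem (S.add_mem (hE _) (S.smul_mem _ (hmem i))) (S.smul_mem _ (hmem k))

theorem convex_openCone {F κ : Type*} [AddCommGroup F] [Module ℝ F] [Fintype κ] (w : κ → F) :
    Convex ℝ (openCone w) := by
  refine convex_iff_forall_pos.2 ?_
  rintro _ ⟨c, hc, rfl⟩ _ ⟨d, hd, rfl⟩ r t hr ht -
  refine ⟨r • c + t • d, fun j => add_pos (mul_pos hr (hc j)) (mul_pos ht (hd j)), ?_⟩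
  simp [add_smul, Finset.sum_add_distrib, Finset.smul_sum, mul_smul]

/-- The slices at the levels `(1 - s, s)` of a cone generated by vectors at the levels `(1, 0)` and
`(0, 1)` have polynomial volume. -/
theorem measure_cone_slice {ι : Type*} [Fintype ι] (w : ι → E × ℝ × ℝ)
    (hw : ∀ j, (w j).2 = (1, 0) ∨ (w j).2 = (0, 1)) :
    ∃ q : Polynomial ℝ, q.natDegree ≤ Module.finrank ℝ E ∧ ∀ s ∈ Ioo (0 : ℝ) 1,
      μ {x | ∃ c : ι → ℝ, (∀ j, 0 ≤ c j) ∧ ∑ j, c j • w j = (x, 1 - s, s)} ≠ ⊤ →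
      (μ {x | ∃ c : ι → ℝ, (∀ j, 0 ≤ c j) ∧ ∑ j, c j • w j = (x, 1 - s, s)}).toReal
        = q.eval s := by
  classical
  obtain ⟨T, hli, hdisj, hcover⟩ := exists_simplicial_cells w
    ((LinearMap.fst ℝ ℝ ℝ + LinearMap.snd ℝ ℝ ℝ) ∘ₗ LinearMap.snd ℝ E (ℝ × ℝ))
    (fun j => by rcases hw j with h | h <;> simp [h])
  have hex : ∀ σ : Finset ι, ∃ q : Polynomial ℝ, q.natDegree ≤ Module.finrank ℝ E ∧
      (σ ∈ T → ∀ s ∈ Ioo (0 : ℝ) 1,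
        (μ {x | (x, 1 - s, s) ∈ openCone fun j : σ => w j}).toReal = q.eval s) := by
    intro σ
    by_cases hσ : σ ∈ T
    · obtain ⟨q, hq, hq'⟩ := measure_openCone_slice μ (fun j : σ => w j) (fun j => hw j) (hli σ hσ)
      exact ⟨q, hq, fun _ => hq'⟩
    · exact ⟨0, by simp, fun h => (hσ h).elim⟩
  choose q hq hqe using hex
  refine ⟨∑ σ ∈ T.toFinset, q σ, Polynomial.natDegree_sum_le_of_forall_le _ _ fun σ _ => hq σ,
    fun s hs hfin => ?_⟩
  have hset : {x : E | ∃ c : ι → ℝ, (∀ j, 0 ≤ c j) ∧ ∑ j, c j • w j = (x, 1 - s, s)} =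
      ⋃ σ ∈ T.toFinset, {x | (x, 1 - s, s) ∈ openCone fun j : σ => w j} := by
    ext x
    simp only [mem_ofPred_eq, mem_iUnion, mem_toFinset, exists_prop]
    constructor
    · rintro ⟨c, hc, hsum⟩
      rw [← hsum]
      exact hcover c hc
    · rintro ⟨σ, -, c, hc, hsum⟩
      refine ⟨fun j => if h : j ∈ σ then c ⟨j, h⟩ else 0, fun j => ?_, ?_⟩
      · dsimp only
        split_ifs
        exacts [(hc _).le, le_rfl]
      · rw [← hsum, ← Finset.sum_subset (Finset.subset_univ σ) (by intro j _ hj; simp [hj]),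
          ← Finset.sum_coe_sort]
        simp
  rw [hset] at hfin ⊢
  rw [measure_biUnion_finset₀, ENNReal.toReal_sum, Polynomial.eval_finsetSum]
  · exact Finset.sum_congr rfl fun σ hσ => hqe σ (mem_toFinset.1 hσ) s hs
  · exact fun σ hσ => measure_ne_top_of_subset (subset_biUnion_of_mem (u := fun σ : Finset ι =>
      {x : E | (x, 1 - s, s) ∈ openCone fun j : σ => w j}) hσ) hfin
  · intro σ hσ τ hτ hne
    refine Disjoint.aedisjoint ?_
    exact (hdisj (mem_toFinset.1 hσ) (mem_toFinset.1 hτ) hne).preimage fun x => (x, 1 - s, s)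
  · intro σ _
    refine Convex.nullMeasurableSet μ ?_
    intro x hx y hy r t hr ht hrt
    have := convex_openCone _ hx hy hr ht hrt
    have h2 : r • (x, 1 - s, s) + t • (y, 1 - s, s) = (r • x + t • y, 1 - s, s) := by
      have h1 : r = 1 - t := by linarith
      subst h1
      ext
      · simp
      · simp; ring
      · simp; ring
    rwa [h2] at this

end Cells

section Slab

universe u

theorem sum_eq_sum_filter_add_sum_filter_not {α G : Type*} [AddCommMonoid G] (V : Finset α)
    (p : α → Prop) [DecidablePred p] (f : α → G) :
    ∑ y ∈ V, f y = ∑ y : V.filter p, f y + ∑ y : V.filter fun y => ¬ p y, f y := by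
  rw [Finset.sum_coe_sort _ f, Finset.sum_coe_sort _ f, Finset.sum_filter_add_sum_filter_not]

variable {E : Type u} [AddCommGroup E] [Module ℝ E]

/-- The point at height `t` on the line through `p` and `q`. -/
noncomputable def crossing (p q : E × ℝ) (t : ℝ) : E :=
  ((q.2 - t) / (q.2 - p.2)) • p.1 + ((t - p.2) / (q.2 - p.2)) • q.1

theorem crossing_mem_segment {p q : E × ℝ} {t : ℝ} (hp : p.2 ≤ t) (hq : t ≤ q.2)
    (hpq : p.2 < q.2) : (crossing p q t, t) ∈ segment ℝ p q := by
  have h : 0 < q.2 - p.2 := sub_pos.2 hpq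
  refine ⟨(q.2 - t) / (q.2 - p.2), (t - p.2) / (q.2 - p.2), by
    have := sub_nonneg.2 hq; positivity, by have := sub_nonneg.2 hp; positivity, by
    field_simp; ring, ?_⟩
  ext
  · simp [crossing]
  · simp; field_simp; ring

theorem crossing_combo (p q : E × ℝ) (a b s : ℝ) :
    crossing p q ((1 - s) * a + s * b) = (1 - s) • crossing p q a + s • crossing p q b := by
  simp only [crossing]
  module

theorem exists_crossing_weights {I J : Type*} [Fintype I] [Fintype J] (p : I → E × ℝ)
    (q : J → E × ℝ) (t : ℝ) (hp : ∀ i, (p i).2 < t) (hq : ∀ j, t < (q j).2) (α : I → ℝ)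
    (β : J → ℝ) (hα : ∀ i, 0 ≤ α i) (hβ : ∀ j, 0 ≤ β j) (hsum : ∑ i, α i + ∑ j, β j = 1)
    (ht : ∑ i, α i * (p i).2 + ∑ j, β j * (q j).2 = t) :
    ∃ m : I × J → ℝ, (∀ k, 0 ≤ m k) ∧ ∑ k, m k = 1 ∧
      ∑ k, m k • crossing (p k.1) (q k.2) t = ∑ i, α i • (p i).1 + ∑ j, β j • (q j).1 := by
  set M := ∑ i, α i * (t - (p i).2) with hM
  have hM' : M = ∑ j, β j * ((q j).2 - t) := by
    simp only [hM, mul_sub, Finset.sum_sub_distrib, ← Finset.sum_mul]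
    linear_combination t * hsum - ht
  have hα' : ∀ i, 0 ≤ α i * (t - (p i).2) := fun i => mul_nonneg (hα i) (sub_nonneg.2 (hp i).le)
  have hβ' : ∀ j, 0 ≤ β j * ((q j).2 - t) := fun j => mul_nonneg (hβ j) (sub_nonneg.2 (hq j).le)
  have hM0 : 0 < M := by
    refine (Finset.sum_nonneg fun i _ => hα' i).lt_of_ne fun h0 => ?_
    have h1 : ∀ i, α i = 0 := fun i => by
      have := (Finset.sum_eq_zero_iff_of_nonneg fun i _ => hα' i).1 h0.symm i (Finset.mem_univ i)
      exact (mul_eq_zero.1 this).resolve_right (sub_pos.2 (hp i)).ne'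
    have h2 : ∀ j, β j = 0 := fun j => by
      have := (Finset.sum_eq_zero_iff_of_nonneg fun j _ => hβ' j).1 (hM'.symm.trans h0.symm) j
        (Finset.mem_univ j)
      exact (mul_eq_zero.1 this).resolve_right (sub_pos.2 (hq j)).ne'
    simp [h1, h2] at hsum
  have hpq : ∀ i j, 0 < (q j).2 - (p i).2 := fun i j => sub_pos.2 ((hp i).trans (hq j))
  refine ⟨fun k => α k.1 * β k.2 * ((q k.2).2 - (p k.1).2) / M, fun k =>
    div_nonneg (mul_nonneg (mul_nonneg (hα _) (hβ _)) (hpq _ _).le) hM0.le, ?_, ?_⟩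
  · have : ∀ k : I × J, α k.1 * β k.2 * ((q k.2).2 - (p k.1).2) / M =
        (α k.1 * (β k.2 * ((q k.2).2 - t)) + (α k.1 * (t - (p k.1).2)) * β k.2) / M :=
      fun k => by ring
    simp only [this, ← Finset.sum_div, Finset.sum_add_distrib, Fintype.sum_prod_type,
      ← Finset.mul_sum, ← Finset.sum_mul, ← hM', ← hM]
    rw [div_eq_one_iff_eq hM0.ne']
    linear_combination M * hsum
  · have : ∀ k : I × J, (α k.1 * β k.2 * ((q k.2).2 - (p k.1).2) / M) •
        crossing (p k.1) (q k.2) t = (β k.2 * ((q k.2).2 - t)) • (M⁻¹ * α k.1) • (p k.1).1 +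
          (α k.1 * (t - (p k.1).2)) • (M⁻¹ * β k.2) • (q k.2).1 := fun k => by
      have := (hpq k.1 k.2).ne'
      simp only [crossing, smul_add, smul_smul]
      congr 2 <;> field_simp
    simp only [this, Finset.sum_add_distrib, Fintype.sum_prod_type]
    rw [Finset.sum_comm (f := fun i j => (α i * (t - (p i).2)) • (M⁻¹ * β j) • (q j).1)]
    simp only [← Finset.sum_smul]
    simp only [← hM', ← hM, smul_smul, mul_inv_cancel_left₀ hM0.ne']

/-- The part of a polytope over an interval free of vertex heights is a cone section generated by
the edges crossing the interval. -/
theorem exists_cone_slice_eq (V : Finset (E × ℝ)) {a b : ℝ} (hab : a < b)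
    (hV : ∀ p ∈ V, p.2 ∉ Ioo a b) :
    ∃ (ι : Type u) (_ : Fintype ι) (w : ι → E × ℝ × ℝ),
      (∀ j, (w j).2 = (1, 0) ∨ (w j).2 = (0, 1)) ∧ ∀ s ∈ Ioo (0 : ℝ) 1,
        {x | (x, (1 - s) * a + s * b) ∈ convexHull ℝ (V : Set (E × ℝ))} =
          {x | ∃ c : ι → ℝ, (∀ j, 0 ≤ c j) ∧ ∑ j, c j • w j = (x, 1 - s, s)} := by
  classical
  let U := V.filter fun p => p.2 ≤ a
  let D := V.filter fun p => ¬ p.2 ≤ a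
  have hU : ∀ p : U, p.1 ∈ V ∧ p.1.2 ≤ a := fun p => Finset.mem_filter.1 p.2
  have hD : ∀ p : D, p.1 ∈ V ∧ b ≤ p.1.2 := fun p => by
    obtain ⟨h1, h2⟩ := Finset.mem_filter.1 p.2
    exact ⟨h1, le_of_not_gt fun h => hV _ h1 ⟨lt_of_not_ge h2, h⟩⟩
  have hmem : ∀ t ∈ Icc a b, ∀ k : U × D, (crossing k.1.1 k.2.1 t, t) ∈
      convexHull ℝ (V : Set (E × ℝ)) := fun t ht k =>
    (convex_convexHull ℝ _).segment_subset (subset_convexHull ℝ _ (hU k.1).1)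
      (subset_convexHull ℝ _ (hD k.2).1)
      (crossing_mem_segment ((hU k.1).2.trans ht.1) (ht.2.trans (hD k.2).2)
        ((hU k.1).2.trans_lt (hab.trans_le (hD k.2).2)))
  refine ⟨(U × D) ⊕ (U × D), inferInstance, Sum.elim (fun k => (crossing k.1.1 k.2.1 a, 1, 0))
    (fun k => (crossing k.1.1 k.2.1 b, 0, 1)), by rintro (k | k) <;> simp, fun s hs => ?_⟩
  have hs1 : 0 < 1 - s := sub_pos.2 hs.2
  ext x
  simp only [mem_ofPred_eq, Fintype.sum_sum_type, Sum.elim_inl, Sum.elim_inr]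
  constructor
  · intro hx
    obtain ⟨l, hl, hl1, hlx⟩ := Finset.mem_convexHull'.1 hx
    have hx1 : ∑ y ∈ V, l y • y.1 = x := by simpa [Prod.fst_sum] using congrArg Prod.fst hlx
    have hx2 : ∑ y ∈ V, l y * y.2 = (1 - s) * a + s * b := by
      simpa [Prod.snd_sum] using congrArg Prod.snd hlx
    rw [sum_eq_sum_filter_add_sum_filter_not V fun p => p.2 ≤ a] at hl1 hx1 hx2
    obtain ⟨m, hm, hm1, hmx⟩ := exists_crossing_weights (fun y : U => y.1) (fun y : D => y.1)
      ((1 - s) * a + s * b) (fun y => (hU y).2.trans_lt (by nlinarith [hs.1]))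
      (fun y => lt_of_lt_of_le (by nlinarith [hs.1]) (hD y).2) (fun y => l y) (fun y => l y)
      (fun y => hl _ (hU y).1) (fun y => hl _ (hD y).1) hl1 hx2
    refine ⟨Sum.elim (fun k => (1 - s) * m k) (fun k => s * m k), ?_, ?_⟩
    · rintro (k | k)
      · exact mul_nonneg hs1.le (hm k)
      · exact mul_nonneg hs.1.le (hm k)
    · simp only [Sum.elim_inl, Sum.elim_inr]
      refine Prod.ext ?_ (Prod.ext ?_ ?_)
      · rw [← hx1, ← hmx]
        simp only [crossing_combo, Prod.fst_add, Prod.fst_sum, Prod.smul_fst, smul_add,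
          Finset.sum_add_distrib, mul_smul, smul_comm (m _)]
      · simp [Prod.fst_sum, Prod.snd_sum, ← Finset.mul_sum, hm1]
      · simp [Prod.snd_sum, ← Finset.mul_sum, hm1]
  · rintro ⟨c, hc, hcx⟩
    have h1 : ∑ k, c (.inl k) • crossing k.1.1 k.2.1 a + ∑ k, c (.inr k) • crossing k.1.1 k.2.1 b
        = x := by simpa [Prod.fst_sum] using congrArg Prod.fst hcx
    have h2 : ∑ k, c (.inl k) = 1 - s := by
      simpa [Prod.fst_sum, Prod.snd_sum] using congrArg (fun v => v.2.1) hcx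
    have h3 : ∑ k, c (.inr k) = s := by
      simpa [Prod.snd_sum] using congrArg (fun v => v.2.2) hcx
    have := (convex_convexHull ℝ (V : Set (E × ℝ))).sum_mem (t := Finset.univ) (w := c)
      (z := Sum.elim (fun k : U × D => (crossing k.1.1 k.2.1 a, a))
        (fun k => (crossing k.1.1 k.2.1 b, b))) (fun j _ => hc j)
      (by rw [Fintype.sum_sum_type, h2, h3]; ring) (by
        rintro (k | k) -
        · exact hmem a ⟨le_rfl, hab.le⟩ k
        · exact hmem b ⟨hab.le, le_rfl⟩ k)
    convert this using 1
    simp only [Fintype.sum_sum_type, Sum.elim_inl, Sum.elim_inr]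
    refine Prod.ext ?_ ?_
    · simp [Prod.fst_sum, h1]
    · simp [Prod.snd_sum, ← Finset.sum_mul, h2, h3]

end Slab

section Continuity

/-- If no interior point of a convex body lies at height `t`, the body lies on one side of `t`. -/
theorem forall_le_or_forall_ge_of_slice {E : Type*} [NormedAddCommGroup E] [NormedSpace ℝ E]
    {P : Set (E × ℝ)} (hP : Convex ℝ P) (hPc : IsClosed P)
    (hint : (interior P).Nonempty) {t : ℝ} (h : ¬ ∃ y, (y, t) ∈ interior P) :
    (∀ p ∈ P, p.2 ≤ t) ∨ ∀ p ∈ P, t ≤ p.2 := by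
  have hcl : P = closure (interior P) := by
    rw [hP.closure_interior_eq_closure_of_nonempty_interior hint, hPc.closure_eq]
  have key : (∀ p ∈ interior P, p.2 ≤ t) ∨ ∀ p ∈ interior P, t ≤ p.2 := by
    by_contra! hcon
    obtain ⟨⟨p, hp, hpt⟩, q, hq, hqt⟩ := hcon
    obtain ⟨⟨y, t'⟩, hy, rfl⟩ := hP.interior.isPreconnected.intermediate_value hq hp
      continuous_snd.continuousOn ⟨hqt.le, hpt.le⟩
    exact h ⟨y, hy⟩
  rw [hcl]
  exact key.imp
    (fun hk => closure_minimal hk (isClosed_le continuous_snd continuous_const))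
    (fun hk => closure_minimal hk (isClosed_le continuous_const continuous_snd))

variable {E : Type*} [NormedAddCommGroup E] [NormedSpace ℝ E] [FiniteDimensional ℝ E]
  [MeasurableSpace E] [BorelSpace E] (μ : Measure E) [μ.IsAddHaarMeasure]

theorem measure_slice_frontier {P : Set (E × ℝ)} (hP : Convex ℝ P) {t : ℝ}
    (h : ∃ y, (y, t) ∈ interior P) : μ {x | (x, t) ∈ P ∧ (x, t) ∉ interior P} = 0 := by
  obtain ⟨y, hy⟩ := h
  have hconv : Convex ℝ {x | (x, t) ∈ P} := by
    intro x hx z hz r s hr hs hrs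
    have := hP hx hz hr hs hrs
    have h2 : r • (x, t) + s • (z, t) = (r • x + s • z, t) := by
      ext <;> simp [← add_mul, hrs]
    rwa [h2] at this
  refine measure_mono_null (fun x hx => ?_) (hconv.addHaar_frontier μ)
  rw [mem_ofPred_eq] at hx
  refine ⟨subset_closure hx.1, fun hint => hx.2 ?_⟩
  have hcont : Filter.Tendsto (fun r : ℝ => x + r • (x - y)) (nhds 0) (nhds x) := by
    have : Continuous fun r : ℝ => x + r • (x - y) := by fun_prop
    simpa using this.tendsto 0
  obtain ⟨r, hr, hr0⟩ := (((hcont.eventually (mem_interior_iff_mem_nhds.1 hint)).filter_mono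
    nhdsWithin_le_nhds).and (self_mem_nhdsWithin (s := Ioi (0 : ℝ)))).exists
  have hr0 : 0 < r := hr0
  have := hP.combo_interior_self_mem_interior hy hr (a := r / (1 + r)) (b := 1 / (1 + r))
    (by positivity) (by positivity) (by field_simp; ring)
  convert this using 1
  refine Prod.ext ?_ ?_
  · simp only [Prod.fst_add, Prod.smul_fst]
    have h1 : (1 + r) ≠ 0 := by positivity
    match_scalars
    · field_simp
    · field_simp
      ring
  · simp
    field_simp
    ring

theorem continuous_measure_slice {P : Set (E × ℝ)} (hP : Convex ℝ P) (hPc : IsCompact P)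
    (hint : (interior P).Nonempty)
    (hnull : ∀ t : ℝ, ((∀ p ∈ P, p.2 ≤ t) ∨ ∀ p ∈ P, t ≤ p.2) → μ {x | (x, t) ∈ P} = 0) :
    Continuous fun t => μ {x | (x, t) ∈ P} := by
  refine continuous_iff_continuousAt.2 fun t => ?_
  have hmeas : ∀ t : ℝ, MeasurableSet {x | (x, t) ∈ P} := fun t =>
    (hPc.isClosed.preimage (by fun_prop : Continuous fun x : E => (x, t))).measurableSet
  have hB : IsCompact (Prod.fst '' P) := hPc.image continuous_fst
  refine tendsto_measure_of_ae_tendsto_indicator (nhds t) (hmeas t) hmeas hB.measurableSet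
    hB.measure_lt_top.ne (.of_forall fun i x hx => ⟨_, hx, rfl⟩) ?_
  have hN : μ {x | (x, t) ∈ P ∧ (x, t) ∉ interior P} = 0 := by
    by_cases h : ∃ y, (y, t) ∈ interior P
    · exact measure_slice_frontier μ hP h
    · exact measure_mono_null (fun x hx => hx.1)
        (hnull t (forall_le_or_forall_ge_of_slice hP hPc.isClosed hint h))
  have hN' : ∀ᵐ x ∂μ, ¬ ((x, t) ∈ P ∧ (x, t) ∉ interior P) := measure_eq_zero_iff_ae_notMem.1 hN
  filter_upwards [hN'] with x hx
  have hc : Filter.Tendsto (fun s : ℝ => (x, s)) (nhds t) (nhds (x, t)) :=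
    Continuous.tendsto (by fun_prop) t
  by_cases hxP : (x, t) ∈ P
  · have hxi : (x, t) ∈ interior P := by simpa [hxP] using hx
    filter_upwards [hc.eventually (mem_interior_iff_mem_nhds.1 hxi)] with s hs
    exact iff_of_true hs hxP
  · filter_upwards [hc.eventually (hPc.isClosed.isOpen_compl.mem_nhds hxP)] with s hs
    exact iff_of_false hs hxP

end Continuity

/-- Let `P = conv(V)` be a compact full-dimensional convex polytope in
`ℝ^n × ℝ ≅ ℝ^d` (`d = n+1`) with no supporting hyperplane parallel to
`{x_d = 0}` (no facet of `P` lies in a horizontal hyperplane).  Then the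
slice-volume function `φ(t) = Vol_{d-1}(P ∩ {x_d = t})` is continuous on `ℝ`,
and on every open interval containing no last-coordinate of a vertex of `P`
(in particular on each `(τ_i, τ_{i+1})` for consecutive vertex levels) it
agrees with a polynomial of degree `≤ d - 1 = n`. -/
theorem slice_volume_continuous_piecewise_polynomial
    (n : ℕ) (V : Finset (EuclideanSpace ℝ (Fin n) × ℝ))
    (P : Set (EuclideanSpace ℝ (Fin n) × ℝ))
    (hP : P = convexHull ℝ (V : Set (EuclideanSpace ℝ (Fin n) × ℝ)))
    (hint : (interior P).Nonempty)
    (hsupp : ∀ c : ℝ,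
      ((∀ p ∈ P, p.2 ≤ c) ∨ (∀ p ∈ P, c ≤ p.2)) → (∃ p ∈ P, p.2 = c) →
      Module.finrank ℝ
        (affineSpan ℝ {p : EuclideanSpace ℝ (Fin n) × ℝ | p ∈ P ∧ p.2 = c}).direction < n)
    (φ : ℝ → ℝ)
    (hφ : ∀ t : ℝ,
      φ t = (volume {x : EuclideanSpace ℝ (Fin n) | (x, t) ∈ P}).toReal) :
    Continuous φ ∧
      ∀ a b : ℝ, (∀ p ∈ V, Prod.snd p ∉ Set.Ioo a b) →
        ∃ q : Polynomial ℝ, q.natDegree ≤ n ∧ ∀ t ∈ Set.Ioo a b, φ t = q.eval t := by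
  have hconv : Convex ℝ P := by
    rw [hP]; exact convex_convexHull ℝ _
  have hcomp : IsCompact P := by
    rw [hP]; exact V.finite_toSet.isCompact_convexHull ℝ
  have hfin : ∀ t : ℝ, volume {x : EuclideanSpace ℝ (Fin n) | (x, t) ∈ P} ≠ ⊤ := fun t =>
    have hsub : {x : EuclideanSpace ℝ (Fin n) | (x, t) ∈ P} ⊆ Prod.fst '' P :=
      fun x hx => ⟨(x, t), hx, rfl⟩
    ((measure_mono hsub).trans_lt (hcomp.image continuous_fst).measure_lt_top).ne
  obtain rfl : φ = _ := funext hφ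
  refine ⟨?_, fun a b hab => ?_⟩
  · refine continuous_iff_continuousAt.2 fun t =>
      (ENNReal.tendsto_toReal (hfin t)).comp (Continuous.tendsto
        (continuous_measure_slice volume hconv hcomp hint fun c hc => ?_) t)
    rcases eq_empty_or_nonempty {x : EuclideanSpace ℝ (Fin n) | (x, c) ∈ P} with h | ⟨x₀, hx₀⟩
    · simp [h]
    have hrank := hsupp c hc ⟨_, hx₀, rfl⟩
    set Q : AffineSubspace ℝ (EuclideanSpace ℝ (Fin n) × ℝ) :=
      affineSpan ℝ {p | p ∈ P ∧ p.2 = c}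
    set A : AffineSubspace ℝ (EuclideanSpace ℝ (Fin n)) := Q.map (LinearMap.fst ℝ _ ℝ).toAffineMap
    refine measure_mono_null (t := A) (fun x hx => ?_)
      (Measure.addHaar_affineSubspace volume A fun hA => ?_)
    · exact ⟨(x, c), subset_affineSpan ℝ _ ⟨hx, rfl⟩, rfl⟩
    · have h1 : A.direction = Q.direction.map (LinearMap.fst ℝ _ ℝ) := by
        simp [A, AffineSubspace.map_direction]
      rw [hA, AffineSubspace.direction_top] at h1
      have h2 := Submodule.finrank_map_le (LinearMap.fst ℝ (EuclideanSpace ℝ (Fin n)) ℝ)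
        Q.direction
      rw [← h1, finrank_top, finrank_euclideanSpace_fin] at h2
      exact absurd hrank h2.not_gt
  · rcases le_or_gt b a with hba | hlt
    · exact ⟨0, by simp, fun t ht => by simp [Ioo_eq_empty hba.not_gt] at ht⟩
    have hd : 0 < b - a := sub_pos.2 hlt
    obtain ⟨ι, _, w, hw, hslice⟩ := exists_cone_slice_eq V hlt hab
    obtain ⟨q, hq, hqe⟩ := measure_cone_slice (volume : Measure (EuclideanSpace ℝ (Fin n))) w hw
    rw [finrank_euclideanSpace_fin] at hq
    refine ⟨q.comp (Polynomial.C (b - a)⁻¹ * (Polynomial.X - Polynomial.C a)), ?_, fun t ht => ?_⟩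
    · refine Polynomial.natDegree_comp_le.trans ?_
      have h1 : (Polynomial.C (b - a)⁻¹ * (Polynomial.X - Polynomial.C a)).natDegree ≤ 1 :=
        (Polynomial.natDegree_C_mul_le _ _).trans (Polynomial.natDegree_X_sub_C_le a)
      nlinarith
    · set s := (b - a)⁻¹ * (t - a) with hs
      have hs01 : s ∈ Ioo (0 : ℝ) 1 := by
        refine ⟨mul_pos (inv_pos.2 hd) (sub_pos.2 ht.1), ?_⟩
        rw [hs, inv_mul_lt_one₀ hd]
        linarith [ht.2]
      have hts : (1 - s) * a + s * b = t := by
        rw [hs]; field_simp; ring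
      have hset := hslice s hs01
      rw [hts, ← hP] at hset
      have := hqe s hs01 (hset ▸ hfin t)
      simpa [hset, hs] using this
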